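/- Let bp(I) be the blueprint obtained from a failed run of Prove_C on input I, and let G be a C-saturated seq-tree of bp(I) with component (w, i). If a box formula [x]C belongs to the consequent of component (w,i) of G (x ∈ {•,◦}), then there exists a C-saturated seq-tree H of bp(I) with components (u, j) and (v, j) such that H ⊨ (u,j) ↠_x^C (v,j), there is a morphic sequence (w,i) ⟶_σ (u,j), and C belongs to the consequent of (v,j) in H. -/

import Mathlib

/-! # Core definitions: intuitionistic tense logic, bi-relational semantics,
nested sequents (seq-trees), the calculus NIK_tC, proof search, computation
trees, morphisms and blueprints. -/

/-- Formulae of the tense language `𝓛`: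
`A ::= p | ⊥ | A ∨ A | A ∧ A | A ⊃ A | ◇A | ◆A | □A | ■A`. -/
inductive Fml : Type where
  | atom : ℕ → Fml
  | bot  : Fml
  | or   : Fml → Fml → Fml
  | and  : Fml → Fml → Fml
  | imp  : Fml → Fml → Fml
  | dia  : Fml → Fml   -- ◇ (forward diamond)
  | bdia : Fml → Fml   -- ◆ (backward diamond)
  | box  : Fml → Fml   -- □ (forward box)
  | bbox : Fml → Fml   -- ■ (backward box)
  deriving DecidableEq

namespace Fml

/-- Modal depth of a formula. -/
def mdep : Fml → ℕ
  | atom _ => 0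
  | bot => 0
  | or A B => max A.mdep B.mdep
  | and A B => max A.mdep B.mdep
  | imp A B => max A.mdep B.mdep
  | dia A => A.mdep + 1
  | bdia A => A.mdep + 1
  | box A => A.mdep + 1
  | bbox A => A.mdep + 1

/-- The set of subformulae of a formula. -/
def subf : Fml → Finset Fml
  | atom p => {atom p}
  | bot => {bot}
  | or A B => insert (or A B) (A.subf ∪ B.subf)
  | and A B => insert (and A B) (A.subf ∪ B.subf)
  | imp A B => insert (imp A B) (A.subf ∪ B.subf)
  | dia A => insert (dia A) A.subf
  | bdia A => insert (bdia A) A.subf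
  | box A => insert (box A) A.subf
  | bbox A => insert (bbox A) A.subf

/-- `⟨x⟩`: the diamond determined by the direction `x` (`true` = forward `◇`,
`false` = backward `◆`). -/
def diaF : Bool → Fml → Fml
  | true, A => dia A
  | false, A => bdia A

/-- `[x]`: the box determined by the direction `x` (`true` = forward `□`,
`false` = backward `■`). -/
def boxF : Bool → Fml → Fml
  | true, A => box A
  | false, A => bbox A

end Fml

/-- A bi-relational model `M = (W, ≤, R, V)`: `≤` is a pre-order, `R` satisfies
the confluence conditions (F1) and (F2), and `V` is monotone along `≤`. -/
structure Model where
  W : Type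
  le : W → W → Prop
  R : W → W → Prop
  val : W → ℕ → Prop
  nonempty : Nonempty W
  le_refl : ∀ w, le w w
  le_trans : ∀ {w u v}, le w u → le u v → le w v
  F1 : ∀ {w w' v}, le w w' → R w v → ∃ v', R w' v' ∧ le v v'
  F2 : ∀ {w v v'}, R w v → le v v' → ∃ w', le w w' ∧ R w' v'
  mono : ∀ {w u p}, le w u → val w p → val u p

/-- The satisfaction relation `M, w ⊨ A`. -/
def Model.Sat (M : Model) : M.W → Fml → Prop
  | w, .atom p => M.val w p
  | _, .bot => False
  | w, .or A B => M.Sat w A ∨ M.Sat w B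
  | w, .and A B => M.Sat w A ∧ M.Sat w B
  | w, .imp A B => ∀ u, M.le w u → M.Sat u A → M.Sat u B
  | w, .dia A => ∃ u, M.R w u ∧ M.Sat u A
  | w, .bdia A => ∃ u, M.R u w ∧ M.Sat u A
  | w, .box A => ∀ u v, M.le w u → M.R u v → M.Sat v A
  | w, .bbox A => ∀ u v, M.le w u → M.R v u → M.Sat v A

/-- `M` is based on a frame in the class `F_C`, where the subset
`C ⊆ {T, B, D}` is encoded by the three Boolean flags `ct`, `cb`, `cd`:
`R` is reflexive if `T ∈ C`, symmetric if `B ∈ C`, and serial if `D ∈ C`. -/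
def Model.InClass (M : Model) (ct cb cd : Bool) : Prop :=
  (ct = true → ∀ w, M.R w w) ∧
  (cb = true → ∀ w u, M.R w u → M.R u w) ∧
  (cd = true → ∀ w, ∃ u, M.R w u)

/-- A Gentzen sequent `Γ ⊢ Δ` (finite sets of formulae). -/
abbrev GSeq : Type := Finset Fml × Finset Fml

/-- A seq-tree (equivalently, a nested sequent): a finite rooted tree whose
vertices (names, drawn from `ℕ`) are labelled with Gentzen sequents and whose
edges are labelled with a direction (`true` = forward `•`, `false` =
backward `◦`). -/
structure SeqTree where
  verts : Finset ℕ
  root : ℕ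
  edges : Finset (ℕ × ℕ)
  elabel : ℕ → ℕ → Bool
  vlab : ℕ → GSeq
  root_mem : root ∈ verts
  edges_sub : ∀ e ∈ edges, e.1 ∈ verts ∧ e.2 ∈ verts
  root_no_parent : ∀ u, (u, root) ∉ edges
  parent_unique : ∀ v ∈ verts, ∀ u u', (u, v) ∈ edges → (u', v) ∈ edges → u = u'
  connected : ∀ v ∈ verts, Relation.ReflTransGen (fun a b => (a, b) ∈ edges) root v

namespace SeqTree

/-- The antecedent (input formulae) of the `w`-component. -/
def ant (T : SeqTree) (w : ℕ) : Finset Fml := (T.vlab w).1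

/-- The consequent (output formulae) of the `w`-component. -/
def suc (T : SeqTree) (w : ℕ) : Finset Fml := (T.vlab w).2

/-- `T.AtDepth w k`: the component `w` occurs at depth `k` in `T`. -/
inductive AtDepth (T : SeqTree) : ℕ → ℕ → Prop where
  | root : T.AtDepth T.root 0
  | step {u v k} : T.AtDepth u k → (u, v) ∈ T.edges → T.AtDepth v (k + 1)

/-- `w` is a leaf of the seq-tree `T`. -/
def IsLeaf (T : SeqTree) (w : ℕ) : Prop := w ∈ T.verts ∧ ∀ u, (w, u) ∉ T.edges

/-- The modal depth of a nested sequent: the maximum over components `w` at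
depth `k` of `(modal depth of a formula at w) + k`. -/
noncomputable def mdep (T : SeqTree) : ℕ :=
  sSup {n | ∃ w ∈ T.verts, ∃ k, T.AtDepth w k ∧ ∃ A ∈ T.ant w ∪ T.suc w, n = A.mdep + k}

/-- `T ⊨ w ↠ₓ^C u`: the C-closure reachability relation of Definition 3.3,
with `C ⊆ {T,B}` encoded by the flags `ct`, `cb`. -/
def Reach (T : SeqTree) (ct cb : Bool) (x : Bool) (w u : ℕ) : Prop :=
  ((w, u) ∈ T.edges ∧ T.elabel w u = x) ∨
  ((u, w) ∈ T.edges ∧ T.elabel u w = !x) ∨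
  (ct = true ∧ w = u ∧ w ∈ T.verts) ∨
  (cb = true ∧ (((w, u) ∈ T.edges ∧ T.elabel w u = !x) ∨
                ((u, w) ∈ T.edges ∧ T.elabel u w = x)))

/-- All formulae occurring in `T`, together with their subformulae. -/
def subfs (T : SeqTree) : Finset Fml :=
  (T.verts.biUnion fun w => T.ant w ∪ T.suc w).biUnion Fml.subf

end SeqTree

/-- `M, ι ⊨ T`: satisfaction of a seq-tree on a model under an
`M`-interpretation `ι` (Definition 3.2): if every `•`-edge `(u,v)` satisfies
`ι(u) R ι(v)` and every `◦`-edge `(u,v)` satisfies `ι(v) R ι(u)`, then some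
component `v` satisfies `M, ι(v) ⊨ ⋀Γ ⊃ ⋁Δ`. -/
def Model.SatSeq (M : Model) (T : SeqTree) (ι : ℕ → M.W) : Prop :=
  (∀ e ∈ T.edges, (T.elabel e.1 e.2 = true → M.R (ι e.1) (ι e.2)) ∧
                  (T.elabel e.1 e.2 = false → M.R (ι e.2) (ι e.1))) →
  ∃ v ∈ T.verts, ∀ u, M.le (ι v) u →
    (∀ A ∈ T.ant v, M.Sat u A) → ∃ B ∈ T.suc v, M.Sat u B

/-- A default (trivial) seq-tree. -/
def SeqTree.triv : SeqTree where
  verts := {0}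
  root := 0
  edges := ∅
  elabel := fun _ _ => true
  vlab := fun _ => (∅, ∅)
  root_mem := Finset.mem_singleton_self 0
  edges_sub := by intro e he; simp at he
  root_no_parent := by intro u h; simp at h
  parent_unique := by intro v _ u u' h; simp at h
  connected := by
    intro v hv
    have hv0 : v = 0 := Finset.mem_singleton.mp hv
    subst hv0
    exact Relation.ReflTransGen.refl

instance : Inhabited SeqTree := ⟨SeqTree.triv⟩

/-- The nested sequent `⊢ A` consisting of a single component with empty
antecedent and consequent `{A}`. -/
def singleSeq (A : Fml) : SeqTree where
  verts := {0}
  root := 0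
  edges := ∅
  elabel := fun _ _ => true
  vlab := fun _ => (∅, {A})
  root_mem := Finset.mem_singleton_self 0
  edges_sub := by intro e he; simp at he
  root_no_parent := by intro u h; simp at h
  parent_unique := by intro v _ u u' h; simp at h
  connected := by
    intro v hv
    have hv0 : v = 0 := Finset.mem_singleton.mp hv
    subst hv0
    exact Relation.ReflTransGen.refl

/-! ## Morphisms between seq-trees -/

/-- A weak morphism between seq-trees: a root-preserving vertex map that
preserves edges and edge labels. -/
def WeakMorphism (T T' : SeqTree) (f : ℕ → ℕ) : Prop :=
  (∀ v ∈ T.verts, f v ∈ T'.verts) ∧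
  f T.root = T'.root ∧
  ∀ u v, (u, v) ∈ T.edges → (f u, f v) ∈ T'.edges ∧ T.elabel u v = T'.elabel (f u) (f v)

/-- A strong morphism: a weak morphism additionally preserving vertex labels. -/
def StrongMorphism (T T' : SeqTree) (f : ℕ → ℕ) : Prop :=
  WeakMorphism T T' f ∧ ∀ v ∈ T.verts, T.vlab v = T'.vlab (f v)

/-- Morphic equivalence `T ≃ T'`: strong morphisms exist in both directions. -/
def MorphEquiv (T T' : SeqTree) : Prop :=
  (∃ f, StrongMorphism T T' f) ∧ (∃ g, StrongMorphism T' T g)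

/-- `T ∈ S(I)`: all vertex labels of `T` are built from subformulae of `I`. -/
def InS (I T : SeqTree) : Prop := ∀ w ∈ T.verts, T.ant w ∪ T.suc w ⊆ I.subfs

/-- `T` has depth at most `k`. -/
def DepthLE (T : SeqTree) (k : ℕ) : Prop := ∀ v n, T.AtDepth v n → n ≤ k

/-! ## The rules of the calculus `NIK_tC` -/

/-- Two seq-trees share the same underlying shape (vertices, root, edges,
edge labels). -/
def sameShape (T T' : SeqTree) : Prop :=
  T'.verts = T.verts ∧ T'.root = T.root ∧ T'.edges = T.edges ∧ T'.elabel = T.elabel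

/-- `T'` is `T` with the label of the component `w` replaced by `s`. -/
def updAt (T : SeqTree) (w : ℕ) (s : GSeq) (T' : SeqTree) : Prop :=
  sameShape T T' ∧ T'.vlab = Function.update T.vlab w s

/-- `T'` is `T` extended with a fresh child `u` of `w`, over an edge labelled
`x`, with component label `s`. -/
def extendAt (T : SeqTree) (w u : ℕ) (x : Bool) (s : GSeq) (T' : SeqTree) : Prop :=
  w ∈ T.verts ∧ u ∉ T.verts ∧
  T'.verts = insert u T.verts ∧ T'.root = T.root ∧
  T'.edges = insert (w, u) T.edges ∧
  T'.elabel = (fun a b => if a = w ∧ b = u then x else T.elabel a b) ∧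
  T'.vlab = Function.update T.vlab u s

/-- The rule `∨L` (conclusion `T`, premises `T1`, `T2`). -/
def OrLRule (T : SeqTree) (w : ℕ) (A B : Fml) (T1 T2 : SeqTree) : Prop :=
  ∃ Γ, w ∈ T.verts ∧ T.ant w = insert (A.or B) Γ ∧
    updAt T w (insert A Γ, T.suc w) T1 ∧ updAt T w (insert B Γ, T.suc w) T2

/-- The rule `∨R`. -/
def OrRRule (T : SeqTree) (w : ℕ) (A B : Fml) (T' : SeqTree) : Prop :=
  ∃ Δ, w ∈ T.verts ∧ T.suc w = insert (A.or B) Δ ∧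
    updAt T w (T.ant w, insert A (insert B Δ)) T'

/-- The rule `∧L`. -/
def AndLRule (T : SeqTree) (w : ℕ) (A B : Fml) (T' : SeqTree) : Prop :=
  ∃ Γ, w ∈ T.verts ∧ T.ant w = insert (A.and B) Γ ∧
    updAt T w (insert A (insert B Γ), T.suc w) T'

/-- The rule `∧R`. -/
def AndRRule (T : SeqTree) (w : ℕ) (A B : Fml) (T1 T2 : SeqTree) : Prop :=
  ∃ Δ, w ∈ T.verts ∧ T.suc w = insert (A.and B) Δ ∧
    updAt T w (T.ant w, insert A Δ) T1 ∧ updAt T w (T.ant w, insert B Δ) T2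

/-- The rule `⊃L`. -/
def ImpLRule (T : SeqTree) (w : ℕ) (A B : Fml) (T1 T2 : SeqTree) : Prop :=
  ∃ Γ, w ∈ T.verts ∧ T.ant w = insert (A.imp B) Γ ∧
    updAt T w (T.ant w, insert A (T.suc w)) T1 ∧ updAt T w (insert B Γ, T.suc w) T2

/-- The (non-invertible) rule `⊃R`: all consequents of all other components are
deleted, and `A ⊢ B` is adjoined at `w`. -/
def ImpRRule (T : SeqTree) (w : ℕ) (A B : Fml) (T' : SeqTree) : Prop :=
  w ∈ T.verts ∧ A.imp B ∈ T.suc w ∧ sameShape T T' ∧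
  (∀ v, v ≠ w → T'.vlab v = (T.ant v, ∅)) ∧
  T'.vlab w = (insert A (T.ant w), {B})

/-- The rule `⟨x⟩L`: a fresh `x`-child containing `A` in its antecedent is
created. -/
def DiaLRule (T : SeqTree) (w u : ℕ) (x : Bool) (A : Fml) (T' : SeqTree) : Prop :=
  ∃ Γ, w ∈ T.verts ∧ u ∉ T.verts ∧ T.ant w = insert (Fml.diaF x A) Γ ∧
    T'.verts = insert u T.verts ∧ T'.root = T.root ∧
    T'.edges = insert (w, u) T.edges ∧
    T'.elabel = (fun a b => if a = w ∧ b = u then x else T.elabel a b) ∧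
    T'.vlab = fun v => if v = u then ({A}, ∅) else if v = w then (Γ, T.suc w) else T.vlab v

/-- The propagation rule `⟨x⟩R`, restricted by the C-closure reachability
relation `w ↠ₓ^C u`. -/
def DiaRRule (ct cb : Bool) (T : SeqTree) (w u : ℕ) (x : Bool) (A : Fml) (T' : SeqTree) : Prop :=
  w ∈ T.verts ∧ u ∈ T.verts ∧ Fml.diaF x A ∈ T.suc w ∧ T.Reach ct cb x w u ∧
  updAt T u (T.ant u, insert A (T.suc u)) T'

/-- The propagation rule `[x]L`, restricted by `w ↠ₓ^C u`. -/
def BoxLRule (ct cb : Bool) (T : SeqTree) (w u : ℕ) (x : Bool) (A : Fml) (T' : SeqTree) : Prop :=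
  w ∈ T.verts ∧ u ∈ T.verts ∧ Fml.boxF x A ∈ T.ant w ∧ T.Reach ct cb x w u ∧
  updAt T u (insert A (T.ant u), T.suc u) T'

/-- The (non-invertible) rule `[x]R`: all consequents are deleted and a fresh
`x`-child `⊢ A` is created. -/
def BoxRRule (T : SeqTree) (w u : ℕ) (x : Bool) (A : Fml) (T' : SeqTree) : Prop :=
  w ∈ T.verts ∧ u ∉ T.verts ∧ Fml.boxF x A ∈ T.suc w ∧
  T'.verts = insert u T.verts ∧ T'.root = T.root ∧
  T'.edges = insert (w, u) T.edges ∧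
  T'.elabel = (fun a b => if a = w ∧ b = u then x else T.elabel a b) ∧
  (∀ v ∈ T.verts, T'.vlab v = (T.ant v, ∅)) ∧
  T'.vlab u = (∅, {A})

/-- The rule `d`: an empty fresh `•`-child is adjoined. -/
def DRule (T : SeqTree) (w u : ℕ) (T' : SeqTree) : Prop :=
  extendAt T w u true (∅, ∅) T'

/-- Provability in the nested sequent calculus `NIK_tC`, where
`C ⊆ {T, B, D}` is encoded by the Boolean flags `ct`, `cb`, `cd`
(the rule `d` belongs to the calculus iff `D ∈ C`). -/
inductive Prov (ct cb cd : Bool) : SeqTree → Prop where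
  | id {T : SeqTree} {w p} : w ∈ T.verts → Fml.atom p ∈ T.ant w → Fml.atom p ∈ T.suc w →
      Prov ct cb cd T
  | botL {T : SeqTree} {w} : w ∈ T.verts → Fml.bot ∈ T.ant w → Prov ct cb cd T
  | orL {T w A B T1 T2} : OrLRule T w A B T1 T2 → Prov ct cb cd T1 → Prov ct cb cd T2 →
      Prov ct cb cd T
  | orR {T w A B T'} : OrRRule T w A B T' → Prov ct cb cd T' → Prov ct cb cd T
  | andL {T w A B T'} : AndLRule T w A B T' → Prov ct cb cd T' → Prov ct cb cd T
  | andR {T w A B T1 T2} : AndRRule T w A B T1 T2 → Prov ct cb cd T1 → Prov ct cb cd T2 →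
      Prov ct cb cd T
  | impL {T w A B T1 T2} : ImpLRule T w A B T1 T2 → Prov ct cb cd T1 → Prov ct cb cd T2 →
      Prov ct cb cd T
  | impR {T w A B T'} : ImpRRule T w A B T' → Prov ct cb cd T' → Prov ct cb cd T
  | diaL {T w u x A T'} : DiaLRule T w u x A T' → Prov ct cb cd T' → Prov ct cb cd T
  | diaR {T w u x A T'} : DiaRRule ct cb T w u x A T' → Prov ct cb cd T' → Prov ct cb cd T
  | boxL {T w u x A T'} : BoxLRule ct cb T w u x A T' → Prov ct cb cd T' → Prov ct cb cd T
  | boxR {T w u x A T'} : BoxRRule T w u x A T' → Prov ct cb cd T' → Prov ct cb cd T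
  | d {T w u T'} : cd = true → DRule T w u T' → Prov ct cb cd T' → Prov ct cb cd T

/-! ## Saturation, stability, initial sequents -/

/-- An initial sequent: some formula occurs among the input and output
formulae, or `⊥` occurs among the input formulae (lines 1–3 of `Prove_C`). -/
def InitialSeq (T : SeqTree) : Prop :=
  (∃ A : Fml, (∃ w ∈ T.verts, A ∈ T.ant w) ∧ (∃ u ∈ T.verts, A ∈ T.suc u)) ∨
  (∃ w ∈ T.verts, Fml.bot ∈ T.ant w)

/-- `C`-saturation of a seq-tree (Definition 4.2); `m` is the modal depth of
the input sequent `I` of the proof search (used by condition `(d)`). -/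
def Saturated (ct cb cd : Bool) (m : ℕ) (T : SeqTree) : Prop :=
  ∀ w ∈ T.verts,
    (∀ A : Fml, ¬ (A ∈ T.ant w ∧ A ∈ T.suc w)) ∧
    Fml.bot ∉ T.ant w ∧
    (∀ A B, A.or B ∈ T.ant w → A ∈ T.ant w ∨ B ∈ T.ant w) ∧
    (∀ A B, A.or B ∈ T.suc w → A ∈ T.suc w ∧ B ∈ T.suc w) ∧
    (∀ A B, A.and B ∈ T.ant w → A ∈ T.ant w ∧ B ∈ T.ant w) ∧
    (∀ A B, A.and B ∈ T.suc w → A ∈ T.suc w ∨ B ∈ T.suc w) ∧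
    (∀ A B, A.imp B ∈ T.ant w → A ∈ T.suc w ∨ B ∈ T.ant w) ∧
    (∀ x A, Fml.diaF x A ∈ T.ant w →
      ∃ u, (w, u) ∈ T.edges ∧ T.elabel w u = x ∧ A ∈ T.ant u) ∧
    (∀ x A u, Fml.diaF x A ∈ T.suc w → T.Reach ct cb x w u → A ∈ T.suc u) ∧
    (∀ x A u, Fml.boxF x A ∈ T.ant w → T.Reach ct cb x w u → A ∈ T.ant u) ∧
    (cd = true → ∀ k, T.AtDepth w k → k ≤ m →
      ∃ u, (w, u) ∈ T.edges ∧ T.elabel w u = true)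

/-- A stable seq-tree: saturated, with no output implications or boxes. -/
def StableSeq (ct cb cd : Bool) (m : ℕ) (T : SeqTree) : Prop :=
  Saturated ct cb cd m T ∧
  ∀ w ∈ T.verts, (∀ A B : Fml, A.imp B ∉ T.suc w) ∧
    (∀ A : Fml, Fml.box A ∉ T.suc w) ∧ (∀ A : Fml, Fml.bbox A ∉ T.suc w)

/-- `T` is a repeat relative to the list `hist` of its ancestors: it is
saturated and admits a strong morphism to some ancestor (its companion). -/
def Repeats (ct cb cd : Bool) (m : ℕ) (hist : List SeqTree) (T : SeqTree) : Prop :=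
  Saturated ct cb cd m T ∧ ∃ H ∈ hist, ∃ f, StrongMorphism T H f

/-- Proof search halts at `T` (relative to the ancestors `hist`): `T` is
initial, stable, or a repeat. -/
def Halted (ct cb cd : Bool) (m : ℕ) (hist : List SeqTree) (T : SeqTree) : Prop :=
  InitialSeq T ∨ StableSeq ct cb cd m T ∨ Repeats ct cb cd m hist T

/-! ## The proof-search steps of `Prove_C` -/

/-- Adjoin `A` to the antecedent of the `w`-component (the operation
`G ◁_w (A ⊢)`). -/
def addAnt (T : SeqTree) (w : ℕ) (A : Fml) (T' : SeqTree) : Prop :=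
  w ∈ T.verts ∧ updAt T w (insert A (T.ant w), T.suc w) T'

/-- Adjoin `A` to the consequent of the `w`-component (the operation
`G ◁_w (⊢ A)`). -/
def addSuc (T : SeqTree) (w : ℕ) (A : Fml) (T' : SeqTree) : Prop :=
  w ∈ T.verts ∧ updAt T w (T.ant w, insert A (T.suc w)) T'

/-- One (bottom-up, non-redundant) rule application performed by the
proof-search algorithm `Prove_C` on input of modal depth `m`, producing the
premise `T'` from `T`.  The disjunctive-branching rule `db` (simultaneous
`⊃R`/`[x]R` applications) is applied only to saturated sequents. -/
def AlgStep (ct cb cd : Bool) (m : ℕ) (T T' : SeqTree) : Prop :=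
  -- ∨L
  (∃ w A B, w ∈ T.verts ∧ Fml.or A B ∈ T.ant w ∧ A ∉ T.ant w ∧ B ∉ T.ant w ∧
    (addAnt T w A T' ∨ addAnt T w B T')) ∨
  -- ∨R
  (∃ w A B, w ∈ T.verts ∧ Fml.or A B ∈ T.suc w ∧ ¬ (A ∈ T.suc w ∧ B ∈ T.suc w) ∧
    updAt T w (T.ant w, insert A (insert B (T.suc w))) T') ∨
  -- ∧L
  (∃ w A B, w ∈ T.verts ∧ Fml.and A B ∈ T.ant w ∧ ¬ (A ∈ T.ant w ∧ B ∈ T.ant w) ∧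
    updAt T w (insert A (insert B (T.ant w)), T.suc w) T') ∨
  -- ∧R
  (∃ w A B, w ∈ T.verts ∧ Fml.and A B ∈ T.suc w ∧ A ∉ T.suc w ∧ B ∉ T.suc w ∧
    (addSuc T w A T' ∨ addSuc T w B T')) ∨
  -- ⊃L
  (∃ w A B, w ∈ T.verts ∧ Fml.imp A B ∈ T.ant w ∧ A ∉ T.suc w ∧ B ∉ T.ant w ∧
    (addSuc T w A T' ∨ addAnt T w B T')) ∨
  -- ⟨x⟩L
  (∃ w u x A, w ∈ T.verts ∧ Fml.diaF x A ∈ T.ant w ∧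
    (¬ ∃ v, T.Reach ct cb x w v ∧ A ∈ T.ant v) ∧
    extendAt T w u x ({A}, ∅) T') ∨
  -- ⟨x⟩R
  (∃ w u x A, w ∈ T.verts ∧ Fml.diaF x A ∈ T.suc w ∧ T.Reach ct cb x w u ∧
    A ∉ T.suc u ∧ addSuc T u A T') ∨
  -- [x]L
  (∃ w u x A, w ∈ T.verts ∧ Fml.boxF x A ∈ T.ant w ∧ T.Reach ct cb x w u ∧
    A ∉ T.ant u ∧ addAnt T u A T') ∨
  -- d
  (cd = true ∧ ∃ w u k, T.AtDepth w k ∧ k ≤ m ∧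
    (¬ ∃ v, (w, v) ∈ T.edges ∧ T.elabel w v = true) ∧ extendAt T w u true (∅, ∅) T') ∨
  -- db (simultaneous ⊃R / [x]R applications on saturated sequents)
  (Saturated ct cb cd m T ∧
    ((∃ w A B, ImpRRule T w A B T') ∨ (∃ w u x A, BoxRRule T w u x A T')))

/-- `T` occurs in the computation tree `ct(I)` generated by `Prove_C(I)`:
it is obtainable from `I` by a sequence of proof-search steps. -/
def InCT (ct cb cd : Bool) (I T : SeqTree) : Prop :=
  Relation.ReflTransGen (AlgStep ct cb cd I.mdep) I T

/-! ## Computation trees -/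

/-- A node of a computation tree: a seq-tree, the Boolean value returned by the
corresponding recursive call of `Prove_C`, and the list of child nodes. -/
inductive RTree : Type where
  | node : SeqTree → Bool → List RTree → RTree

/-- The seq-tree at the root of a computation tree. -/
def RTree.seq : RTree → SeqTree
  | .node T _ _ => T

/-- The Boolean label at the root of a computation tree. -/
def RTree.val : RTree → Bool
  | .node _ b _ => b

/-- The children of the root of a computation tree. -/
def RTree.kids : RTree → List RTree
  | .node _ _ ts => ts

/-- Proof search is still running at `T` (none of the halting conditions of
lines 1–6 of `Prove_C` applies). -/
def Running (ct cb cd : Bool) (m : ℕ) (hist : List SeqTree) (T : SeqTree) : Prop :=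
  ¬ InitialSeq T ∧ ¬ StableSeq ct cb cd m T ∧ ¬ Repeats ct cb cd m hist T

/-- `ValidCT ct cb cd m hist t`: the labelled tree `t` is a computation tree
generated by a run of `Prove_C` (with ancestor list `hist`): each parent is the
conclusion of a rule of `(NIK_tC ∖ {⊃R, [x]R}) ∪ {db}` with its children the
premises, halting nodes are labelled as the algorithm prescribes, conjunctive
branching takes the conjunction of the children's values, and the disjunctive
branching rule `db` (applied to saturated sequents, with one premise for each
output implication and each output box) takes their disjunction. -/
inductive ValidCT (ct cb cd : Bool) (m : ℕ) : List SeqTree → RTree → Prop where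
  | initial {hist T} : InitialSeq T → ValidCT ct cb cd m hist (.node T true [])
  | stable {hist T} : ¬ InitialSeq T → StableSeq ct cb cd m T →
      ValidCT ct cb cd m hist (.node T false [])
  | rep {hist T} : ¬ InitialSeq T → Repeats ct cb cd m hist T →
      ValidCT ct cb cd m hist (.node T false [])
  | orL {hist T w A B t1 t2} : Running ct cb cd m hist T →
      w ∈ T.verts → Fml.or A B ∈ T.ant w → A ∉ T.ant w → B ∉ T.ant w →
      addAnt T w A t1.seq → addAnt T w B t2.seq →
      ValidCT ct cb cd m (T :: hist) t1 → ValidCT ct cb cd m (T :: hist) t2 →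
      ValidCT ct cb cd m hist (.node T (t1.val && t2.val) [t1, t2])
  | orR {hist T w A B t} : Running ct cb cd m hist T →
      w ∈ T.verts → Fml.or A B ∈ T.suc w → ¬ (A ∈ T.suc w ∧ B ∈ T.suc w) →
      updAt T w (T.ant w, insert A (insert B (T.suc w))) t.seq →
      ValidCT ct cb cd m (T :: hist) t →
      ValidCT ct cb cd m hist (.node T t.val [t])
  | andL {hist T w A B t} : Running ct cb cd m hist T →
      w ∈ T.verts → Fml.and A B ∈ T.ant w → ¬ (A ∈ T.ant w ∧ B ∈ T.ant w) →
      updAt T w (insert A (insert B (T.ant w)), T.suc w) t.seq →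
      ValidCT ct cb cd m (T :: hist) t →
      ValidCT ct cb cd m hist (.node T t.val [t])
  | andR {hist T w A B t1 t2} : Running ct cb cd m hist T →
      w ∈ T.verts → Fml.and A B ∈ T.suc w → A ∉ T.suc w → B ∉ T.suc w →
      addSuc T w A t1.seq → addSuc T w B t2.seq →
      ValidCT ct cb cd m (T :: hist) t1 → ValidCT ct cb cd m (T :: hist) t2 →
      ValidCT ct cb cd m hist (.node T (t1.val && t2.val) [t1, t2])
  | impL {hist T w A B t1 t2} : Running ct cb cd m hist T →
      w ∈ T.verts → Fml.imp A B ∈ T.ant w → A ∉ T.suc w → B ∉ T.ant w →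
      addSuc T w A t1.seq → addAnt T w B t2.seq →
      ValidCT ct cb cd m (T :: hist) t1 → ValidCT ct cb cd m (T :: hist) t2 →
      ValidCT ct cb cd m hist (.node T (t1.val && t2.val) [t1, t2])
  | diaL {hist T w u x A t} : Running ct cb cd m hist T →
      w ∈ T.verts → Fml.diaF x A ∈ T.ant w →
      (¬ ∃ v, T.Reach ct cb x w v ∧ A ∈ T.ant v) →
      extendAt T w u x ({A}, ∅) t.seq →
      ValidCT ct cb cd m (T :: hist) t →
      ValidCT ct cb cd m hist (.node T t.val [t])
  | diaR {hist T w u x A t} : Running ct cb cd m hist T →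
      w ∈ T.verts → Fml.diaF x A ∈ T.suc w → T.Reach ct cb x w u → A ∉ T.suc u →
      addSuc T u A t.seq →
      ValidCT ct cb cd m (T :: hist) t →
      ValidCT ct cb cd m hist (.node T t.val [t])
  | boxL {hist T w u x A t} : Running ct cb cd m hist T →
      w ∈ T.verts → Fml.boxF x A ∈ T.ant w → T.Reach ct cb x w u → A ∉ T.ant u →
      addAnt T u A t.seq →
      ValidCT ct cb cd m (T :: hist) t →
      ValidCT ct cb cd m hist (.node T t.val [t])
  | d {hist T w u k t} : Running ct cb cd m hist T →
      cd = true → T.AtDepth w k → k ≤ m →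
      (¬ ∃ v, (w, v) ∈ T.edges ∧ T.elabel w v = true) →
      extendAt T w u true (∅, ∅) t.seq →
      ValidCT ct cb cd m (T :: hist) t →
      ValidCT ct cb cd m hist (.node T t.val [t])
  | db {hist T ts} : Running ct cb cd m hist T →
      Saturated ct cb cd m T →
      (∀ t ∈ ts, ValidCT ct cb cd m (T :: hist) t) →
      (∀ t ∈ ts, (∃ w A B, ImpRRule T w A B t.seq) ∨ (∃ w u x A, BoxRRule T w u x A t.seq)) →
      (∀ w ∈ T.verts, ∀ A B, Fml.imp A B ∈ T.suc w → ∃ t ∈ ts, ImpRRule T w A B t.seq) →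
      (∀ w ∈ T.verts, ∀ x A, Fml.boxF x A ∈ T.suc w → ∃ t ∈ ts, ∃ u, BoxRRule T w u x A t.seq) →
      ValidCT ct cb cd m hist (.node T (ts.any RTree.val) ts)

/-! ## Blueprints and the extracted counter-model -/

/-- The subtree of a computation tree at the address `π` (a list of child
positions); addresses play the role of the positions of the enumeration `η`. -/
def RTree.at? : RTree → List ℕ → Option RTree
  | t, [] => some t
  | t, i :: π =>
    match t.kids[i]? with
    | some t' => t'.at? π
    | none => none

/-- The seq-tree at the address `π` of a computation tree. -/
def RTree.seqAt (t : RTree) (π : List ℕ) : SeqTree :=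
  (t.at? π).elim default RTree.seq

/-- The node at address `π` exists and every node on the path from the root to
it (inclusive) is labelled `F`; these are the nodes of the blueprint `bp(I)`. -/
def FNode (t : RTree) (π : List ℕ) : Prop :=
  ∀ σ, σ <+: π → ∃ s, t.at? σ = some s ∧ s.val = false

/-- Membership in the set `S` of the blueprint: an `F`-reachable node whose
seq-tree is `C`-saturated (an η-renamed saturated seq-tree of `bp(I)`;
the vertex `w` of the seq-tree at address `π` represents the renamed
component `(w, π)`). -/
def InSsat (ct cb cd : Bool) (m : ℕ) (t : RTree) (π : List ℕ) : Prop :=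
  FNode t π ∧ Saturated ct cb cd m (t.seqAt π)

/-- The node at address `π` is a repeat of the blueprint: an `F`-path leaf of
the computation tree that is saturated but not stable. -/
def RepNode (ct cb cd : Bool) (m : ℕ) (t : RTree) (π : List ℕ) : Prop :=
  FNode t π ∧ (∃ s, t.at? π = some s ∧ s.kids = []) ∧
  Saturated ct cb cd m (t.seqAt π) ∧ ¬ StableSeq ct cb cd m (t.seqAt π)

/-- `(gc, gf)` is a family `γ⃗` of strong morphisms mapping each repeat of the
blueprint to its companion: a proper ancestor belonging to `S` (C-saturated,
on an `F`-path) together with a strong morphism onto it. -/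
def GammaOK (ct cb cd : Bool) (m : ℕ) (t : RTree)
    (gc : List ℕ → List ℕ) (gf : List ℕ → ℕ → ℕ) : Prop :=
  ∀ π, RepNode ct cb cd m t π →
    gc π <+: π ∧ gc π ≠ π ∧ InSsat ct cb cd m t (gc π) ∧
    StrongMorphism (t.seqAt π) (t.seqAt (gc π)) (gf π)

/-- One step of a morphic sequence: either a natural morphism between members
of `S` related by `≺_bp*` (mapping `(w, π)` to `(w, π')`), or a strong morphism
of the family `γ⃗` mapping a repeat to its companion. -/
inductive MStep (ct cb cd : Bool) (m : ℕ) (t : RTree)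
    (gc : List ℕ → List ℕ) (gf : List ℕ → ℕ → ℕ) :
    (ℕ × List ℕ) → (ℕ × List ℕ) → Prop where
  | nat {w : ℕ} {π π' : List ℕ} :
      InSsat ct cb cd m t π → InSsat ct cb cd m t π' → π <+: π' →
      w ∈ (t.seqAt π).verts →
      MStep ct cb cd m t gc gf (w, π) (w, π')
  | rep {w : ℕ} {π : List ℕ} :
      RepNode ct cb cd m t π → w ∈ (t.seqAt π).verts →
      MStep ct cb cd m t gc gf (w, π) (gf π w, gc π)

/-- A morphic sequence `(w, π) ⟶_σ (u, π')` in the blueprint. -/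
def MSeq (ct cb cd : Bool) (m : ℕ) (t : RTree)
    (gc : List ℕ → List ℕ) (gf : List ℕ → ℕ → ℕ) :
    (ℕ × List ℕ) → (ℕ × List ℕ) → Prop :=
  Relation.ReflTransGen (MStep ct cb cd m t gc gf)

/-- The set `W` of worlds of the extracted model: the (renamed) components of
the saturated seq-trees of the blueprint. -/
def Worlds (ct cb cd : Bool) (m : ℕ) (t : RTree) : Set (ℕ × List ℕ) :=
  {a | InSsat ct cb cd m t a.2 ∧ a.1 ∈ (t.seqAt a.2).verts}

/-- The modal relation `R` of the extracted model: induced by the C-closure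
reachability relation inside each saturated seq-tree, together with self-loops
at components of depth `m + 1` when `D ∈ C`. -/
def bpR (ct cb cd : Bool) (m : ℕ) (t : RTree) :
    (ℕ × List ℕ) → (ℕ × List ℕ) → Prop :=
  fun a b =>
    (a.2 = b.2 ∧ InSsat ct cb cd m t a.2 ∧ (t.seqAt a.2).Reach ct cb true a.1 b.1) ∨
    (cd = true ∧ a = b ∧ InSsat ct cb cd m t a.2 ∧ (t.seqAt a.2).AtDepth a.1 (m + 1))

/-- The valuation `V` of the extracted model: `(w, π) ∈ V(p)` iff `p` occurs in
the antecedent of the component `(w, π)`. -/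
def bpVal (ct cb cd : Bool) (m : ℕ) (t : RTree) : (ℕ × List ℕ) → ℕ → Prop :=
  fun a p => InSsat ct cb cd m t a.2 ∧ Fml.atom p ∈ (t.seqAt a.2).ant a.1

/-- Satisfaction over raw frame data (the same clauses as `Model.Sat`). -/
def SatR {W : Type} (le R : W → W → Prop) (val : W → ℕ → Prop) : W → Fml → Prop
  | w, .atom p => val w p
  | _, .bot => False
  | w, .or A B => SatR le R val w A ∨ SatR le R val w B
  | w, .and A B => SatR le R val w A ∧ SatR le R val w B
  | w, .imp A B => ∀ u, le w u → SatR le R val u A → SatR le R val u B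
  | w, .dia A => ∃ u, R w u ∧ SatR le R val u A
  | w, .bdia A => ∃ u, R u w ∧ SatR le R val u A
  | w, .box A => ∀ u v, le w u → R u v → SatR le R val v A
  | w, .bbox A => ∀ u v, le w u → R v u → SatR le R val v A

/-- `T'` extends `T` as a labelled tree, possibly enlarging consequents. -/
structure SeqTree.Extends (T T' : SeqTree) : Prop where
  verts : T.verts ⊆ T'.verts
  edges : T.edges ⊆ T'.edges
  elabel : ∀ a b, (a, b) ∈ T.edges → T'.elabel a b = T.elabel a b
  suc : ∀ v ∈ T.verts, T.suc v ⊆ T'.suc v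

namespace SeqTree.Extends

theorem refl (T : SeqTree) : T.Extends T :=
  ⟨subset_rfl, subset_rfl, fun _ _ _ => rfl, fun _ _ => subset_rfl⟩

theorem trans {T T' T'' : SeqTree} (h : T.Extends T') (h' : T'.Extends T'') :
    T.Extends T'' where
  verts := h.verts.trans h'.verts
  edges := h.edges.trans h'.edges
  elabel a b hab := (h'.elabel a b (h.edges hab)).trans (h.elabel a b hab)
  suc v hv := (h.suc v hv).trans (h'.suc v (h.verts hv))

theorem of_updAt {T T' : SeqTree} {w : ℕ} {s : GSeq} (h : updAt T w s T')
    (hs : T.suc w ⊆ s.2) : T.Extends T' := by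
  obtain ⟨⟨hv, -, he, hl⟩, hlab⟩ := h
  refine ⟨hv ▸ subset_rfl, he ▸ subset_rfl, fun _ _ _ => by rw [hl], fun v _ => ?_⟩
  by_cases hvw : v = w
  · subst hvw
    simpa [SeqTree.suc, hlab] using hs
  · simp [SeqTree.suc, hlab, Function.update_of_ne hvw]

theorem of_addAnt {T T' : SeqTree} {w : ℕ} {A : Fml} (h : addAnt T w A T') : T.Extends T' :=
  of_updAt h.2 subset_rfl

theorem of_addSuc {T T' : SeqTree} {w : ℕ} {A : Fml} (h : addSuc T w A T') : T.Extends T' :=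
  of_updAt h.2 (Finset.subset_insert _ _)

theorem of_extendAt {T T' : SeqTree} {w u : ℕ} {x : Bool} {s : GSeq}
    (h : extendAt T w u x s T') : T.Extends T' := by
  obtain ⟨-, hu, hv, -, he, hl, hlab⟩ := h
  refine ⟨hv ▸ Finset.subset_insert _ _, he ▸ Finset.subset_insert _ _, fun a b hab => ?_,
    fun v hvT => ?_⟩
  · have hb : b ≠ u := fun hbu => hu (hbu ▸ (T.edges_sub _ hab).2)
    simp [hl, hb]
  · have hvu : v ≠ u := fun hvu => hu (hvu ▸ hvT)
    simp [SeqTree.suc, hlab, Function.update_of_ne hvu]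

end SeqTree.Extends

theorem RTree.at?_nil (t : RTree) : t.at? [] = some t := by
  rw [RTree.at?]

theorem RTree.at?_cons {t t' : RTree} {i : ℕ} (h : t.kids[i]? = some t') (π : List ℕ) :
    t.at? (i :: π) = t'.at? π := by
  rw [RTree.at?, h]

theorem RTree.exists_kid_of_at?_cons {t s : RTree} {i : ℕ} {π : List ℕ}
    (h : t.at? (i :: π) = some s) : ∃ t', t.kids[i]? = some t' ∧ t'.at? π = some s := by
  cases hk : t.kids[i]? with
  | none => simp [RTree.at?, hk] at h
  | some t' => exact ⟨t', rfl, by rwa [RTree.at?_cons hk] at h⟩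

theorem RTree.at?_append {t s : RTree} {π : List ℕ} (h : t.at? π = some s) (ρ : List ℕ) :
    t.at? (π ++ ρ) = s.at? ρ := by
  induction π generalizing t with
  | nil =>
    rw [RTree.at?_nil, Option.some.injEq] at h
    rw [List.nil_append, h]
  | cons i π ih =>
    obtain ⟨t', hk, h'⟩ := RTree.exists_kid_of_at?_cons h
    rw [List.cons_append, RTree.at?_cons hk, ih h']

theorem RTree.kids_ne_nil_of_proper_prefix {t s s' : RTree} {π ρ : List ℕ} (hpre : π <+: ρ)
    (hne : π ≠ ρ) (hs : t.at? π = some s) (hs' : t.at? ρ = some s') : s.kids ≠ [] := by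
  obtain ⟨τ, rfl⟩ := hpre
  rw [RTree.at?_append hs] at hs'
  cases τ with
  | nil => simp at hne
  | cons i τ =>
    obtain ⟨t', hk, -⟩ := RTree.exists_kid_of_at?_cons hs'
    intro hnil
    simp [hnil] at hk

theorem FNode.nil {t : RTree} (h : t.val = false) : FNode t [] := by
  intro σ hσ
  rw [List.prefix_nil] at hσ
  exact ⟨t, by rw [hσ, RTree.at?_nil], h⟩

theorem FNode.cons {t t' : RTree} {i : ℕ} {π : List ℕ} (h : t.val = false)
    (hk : t.kids[i]? = some t') (hπ : FNode t' π) : FNode t (i :: π) := by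
  intro σ hσ
  rcases List.prefix_cons_iff.mp hσ with rfl | ⟨σ', rfl, hσ'⟩
  · exact ⟨t, RTree.at?_nil t, h⟩
  · rw [RTree.at?_cons hk]
    exact hπ σ' hσ'

theorem FNode.append {t s : RTree} {π ρ : List ℕ} (hπ : FNode t π) (hs : t.at? π = some s)
    (hρ : FNode s ρ) : FNode t (π ++ ρ) := by
  intro σ hσ
  rcases List.prefix_or_prefix_of_prefix hσ (List.prefix_append π ρ) with h | ⟨τ, rfl⟩
  · exact hπ σ h
  · rw [RTree.at?_append hs]
    exact hρ τ ((List.prefix_append_right_inj π).mp hσ)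

/-- Every node of a computation tree is itself the root of one. -/
theorem ValidCT.exists_at {ct cb cd : Bool} {m : ℕ} {hist : List SeqTree} {t s : RTree}
    {π : List ℕ} (ht : ValidCT ct cb cd m hist t) (hs : t.at? π = some s) :
    ∃ hist', ValidCT ct cb cd m hist' s := by
  induction π generalizing t hist with
  | nil =>
    rw [RTree.at?_nil, Option.some.injEq] at hs
    exact ⟨hist, hs ▸ ht⟩
  | cons i π ih =>
    obtain ⟨t', hk, hs'⟩ := RTree.exists_kid_of_at?_cons hs
    have hmem : t' ∈ t.kids := List.mem_of_getElem? hk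
    suffices ∃ hist', ValidCT ct cb cd m hist' t' from
      let ⟨_, h⟩ := this
      ih h hs'
    cases ht with
    | initial => cases hmem
    | stable => cases hmem
    | rep => cases hmem
    | db _ _ hts => exact ⟨_, hts t' hmem⟩
    | orL | andR | impL =>
      rcases List.mem_pair.mp hmem with rfl | rfl <;> exact ⟨_, ‹_›⟩
    | orR | andL | diaL | diaR | boxL | d =>
      rcases List.mem_singleton.mp hmem with rfl
      exact ⟨_, ‹_›⟩

/-- The property of having a saturated descendant along an `F`-path whose seq-tree extends `T`. -/
def HasSaturatedExtension (ct cb cd : Bool) (m : ℕ) (T : SeqTree) (t : RTree) : Prop :=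
  ∃ π s, FNode t π ∧ t.at? π = some s ∧ Saturated ct cb cd m s.seq ∧ T.Extends s.seq

theorem HasSaturatedExtension.of_kid {ct cb cd : Bool} {m : ℕ} {T : SeqTree} {t t' : RTree}
    {i : ℕ} (hval : t.val = false) (hk : t.kids[i]? = some t') (hext : T.Extends t'.seq)
    (h : HasSaturatedExtension ct cb cd m t'.seq t') : HasSaturatedExtension ct cb cd m T t := by
  obtain ⟨π, s, hF, hs, hsat, he⟩ := h
  exact ⟨i :: π, s, hF.cons hval hk, by rw [RTree.at?_cons hk, hs], hsat, hext.trans he⟩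

theorem HasSaturatedExtension.of_saturated {ct cb cd : Bool} {m : ℕ} {t : RTree}
    (hval : t.val = false) (h : Saturated ct cb cd m t.seq) :
    HasSaturatedExtension ct cb cd m t.seq t :=
  ⟨[], t, FNode.nil hval, RTree.at?_nil t, h, SeqTree.Extends.refl _⟩

theorem HasSaturatedExtension.of_two_kids {ct cb cd : Bool} {m : ℕ} {T : SeqTree}
    {t1 t2 : RTree} (hval : (t1.val && t2.val) = false)
    (e1 : T.Extends t1.seq) (e2 : T.Extends t2.seq)
    (h1 : t1.val = false → HasSaturatedExtension ct cb cd m t1.seq t1)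
    (h2 : t2.val = false → HasSaturatedExtension ct cb cd m t2.seq t2) :
    HasSaturatedExtension ct cb cd m T (.node T (t1.val && t2.val) [t1, t2]) := by
  rcases Bool.and_eq_false_iff.mp hval with h | h
  · exact .of_kid (i := 0) hval rfl e1 (h1 h)
  · exact .of_kid (i := 1) hval rfl e2 (h2 h)

theorem ValidCT.hasSaturatedExtension {ct cb cd : Bool} {m : ℕ} {hist : List SeqTree} {t : RTree}
    (ht : ValidCT ct cb cd m hist t) (hval : t.val = false) :
    HasSaturatedExtension ct cb cd m t.seq t := by
  induction ht with
  | initial => cases hval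
  | stable _ h => exact .of_saturated hval h.1
  | rep _ h => exact .of_saturated hval h.1
  | db _ h => exact .of_saturated hval h
  | orL _ _ _ _ _ h1 h2 _ _ ih1 ih2 =>
    exact .of_two_kids hval (.of_addAnt h1) (.of_addAnt h2) ih1 ih2
  | andR _ _ _ _ _ h1 h2 _ _ ih1 ih2 =>
    exact .of_two_kids hval (.of_addSuc h1) (.of_addSuc h2) ih1 ih2
  | impL _ _ _ _ _ h1 h2 _ _ ih1 ih2 =>
    exact .of_two_kids hval (.of_addSuc h1) (.of_addAnt h2) ih1 ih2
  | orR _ _ _ _ h _ ih =>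
    exact .of_kid (i := 0) hval rfl (.of_updAt h
      ((Finset.subset_insert _ _).trans (Finset.subset_insert _ _))) (ih hval)
  | andL _ _ _ _ h _ ih => exact .of_kid (i := 0) hval rfl (.of_updAt h subset_rfl) (ih hval)
  | diaL _ _ _ _ h _ ih => exact .of_kid (i := 0) hval rfl (.of_extendAt h) (ih hval)
  | diaR _ _ _ _ _ h _ ih => exact .of_kid (i := 0) hval rfl (.of_addSuc h) (ih hval)
  | boxL _ _ _ _ _ h _ ih => exact .of_kid (i := 0) hval rfl (.of_addAnt h) (ih hval)
  | d _ _ _ _ _ h _ ih => exact .of_kid (i := 0) hval rfl (.of_extendAt h) (ih hval)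

/-- The only rule applicable to a saturated sequent is `db`, so an output box at a saturated
`F`-node with children has a child created by the rule `[x]R`. -/
theorem ValidCT.exists_boxR_kid {ct cb cd : Bool} {m : ℕ} {hist : List SeqTree} {t : RTree}
    (ht : ValidCT ct cb cd m hist t) (hval : t.val = false) (hsat : Saturated ct cb cd m t.seq)
    (hkids : t.kids ≠ []) {w : ℕ} {x : Bool} {C : Fml} (hw : w ∈ t.seq.verts)
    (hC : Fml.boxF x C ∈ t.seq.suc w) :
    ∃ (i : ℕ) (t' : RTree) (v : ℕ), t.kids[i]? = some t' ∧ t'.val = false ∧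
      ValidCT ct cb cd m (t.seq :: hist) t' ∧ BoxRRule t.seq w v x C t'.seq := by
  cases ht with
  | initial => exact absurd rfl hkids
  | stable => exact absurd rfl hkids
  | rep => exact absurd rfl hkids
  | orL _ hv hA h1 h2 => exact (((hsat _ hv).2.2.1 _ _ hA).elim h1 h2).elim
  | orR _ hv hA h => exact (h ((hsat _ hv).2.2.2.1 _ _ hA)).elim
  | andL _ hv hA h => exact (h ((hsat _ hv).2.2.2.2.1 _ _ hA)).elim
  | andR _ hv hA h1 h2 => exact (((hsat _ hv).2.2.2.2.2.1 _ _ hA).elim h1 h2).elim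
  | impL _ hv hA h1 h2 => exact (((hsat _ hv).2.2.2.2.2.2.1 _ _ hA).elim h1 h2).elim
  | diaL _ hv hA h =>
    obtain ⟨u, he, hl, hu⟩ := (hsat _ hv).2.2.2.2.2.2.2.1 _ _ hA
    exact (h ⟨u, .inl ⟨he, hl⟩, hu⟩).elim
  | diaR _ hv hA hr h => exact (h ((hsat _ hv).2.2.2.2.2.2.2.2.1 _ _ _ hA hr)).elim
  | boxL _ hv hA hr h => exact (h ((hsat _ hv).2.2.2.2.2.2.2.2.2.1 _ _ _ hA hr)).elim
  | d _ hcd hd hk h hext => exact (h ((hsat _ hext.1).2.2.2.2.2.2.2.2.2.2 hcd _ hd hk)).elim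
  | db _ _ hts _ _ hbox =>
    obtain ⟨t', ht', v, hv⟩ := hbox w hw x C hC
    obtain ⟨i, hi⟩ := List.mem_iff_getElem?.mp ht'
    exact ⟨i, t', v, hi, by simpa using List.any_eq_false.mp hval t' ht', hts t' ht', hv⟩

theorem RTree.seqAt_eq {t s : RTree} {π : List ℕ} (h : t.at? π = some s) :
    t.seqAt π = s.seq := by
  simp [RTree.seqAt, h]

/-- An output box at a saturated non-leaf of the blueprint has a witness further up. -/
theorem exists_box_witness_of_kids_ne_nil {ct cb cd : Bool} {m : ℕ} {hist : List SeqTree}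
    {t s : RTree} (hrun : ValidCT ct cb cd m hist t) {π : List ℕ}
    (hπ : InSsat ct cb cd m t π) (hs : t.at? π = some s) (hkids : s.kids ≠ [])
    {w : ℕ} {x : Bool} {C : Fml} (hw : w ∈ (t.seqAt π).verts)
    (hC : Fml.boxF x C ∈ (t.seqAt π).suc w) :
    ∃ (π' : List ℕ) (v : ℕ), π <+: π' ∧ InSsat ct cb cd m t π' ∧
      w ∈ (t.seqAt π').verts ∧ v ∈ (t.seqAt π').verts ∧
      (t.seqAt π').Reach ct cb x w v ∧ C ∈ (t.seqAt π').suc v := by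
  obtain ⟨hF, hsat⟩ := hπ
  rw [RTree.seqAt_eq hs] at hsat hw hC
  have hsval : s.val = false := by
    obtain ⟨s', hs', hv⟩ := hF π (List.prefix_refl π)
    rw [hs, Option.some.injEq] at hs'
    rwa [hs']
  obtain ⟨hist', hvalid⟩ := hrun.exists_at hs
  obtain ⟨i, t', v, hi, hval', hvalid', -, -, -, hverts, -, hedges, hl, -, hlab⟩ :=
    hvalid.exists_boxR_kid hsval hsat hkids hw hC
  obtain ⟨ρ, r, hρ, hr, hrsat, hext⟩ := hvalid'.hasSaturatedExtension hval'
  have hr' : t.at? (π ++ i :: ρ) = some r := by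
    rw [RTree.at?_append hs, RTree.at?_cons hi, hr]
  have hedge : (w, v) ∈ t'.seq.edges := hedges ▸ Finset.mem_insert_self _ _
  have hv : v ∈ t'.seq.verts := hverts ▸ Finset.mem_insert_self _ _
  refine ⟨π ++ i :: ρ, v, List.prefix_append _ _,
    ⟨hF.append hs (hρ.cons hsval hi), ?_⟩, ?_⟩ <;> rw [RTree.seqAt_eq hr']
  · exact hrsat
  · refine ⟨hext.verts (hverts ▸ Finset.mem_insert_of_mem hw), hext.verts hv,
      .inl ⟨hext.edges hedge, ?_⟩, hext.suc v hv ?_⟩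
    · rw [hext.elabel w v hedge, hl]
      simp
    · simp [SeqTree.suc, hlab]

/-- Lemma 4.9(3): in the blueprint of a failed run of
`Prove_C`, if `[x]C` belongs to the consequent of `(w,π)`, then there is a
saturated seq-tree of the blueprint with components `(u,π')` and `(v,π')` such
that `(u,π') ↠ₓ^C (v,π')`, `(w,π) ⟶_σ (u,π')`, and `C` belongs to the
consequent of `(v,π')`. -/
theorem blueprint_box_witness (ct cb cd : Bool) (I : SeqTree) (t : RTree)
    (hrun : ValidCT ct cb cd I.mdep [] t) (hseq : t.seq = I) (hval : t.val = false)
    (gc : List ℕ → List ℕ) (gf : List ℕ → ℕ → ℕ)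
    (hγ : GammaOK ct cb cd I.mdep t gc gf)
    (π : List ℕ) (w : ℕ) (x : Bool) (C : Fml)
    (hπ : InSsat ct cb cd I.mdep t π) (hw : w ∈ (t.seqAt π).verts)
    (hC : Fml.boxF x C ∈ (t.seqAt π).suc w) :
    ∃ (π' : List ℕ) (u v : ℕ), InSsat ct cb cd I.mdep t π' ∧
      u ∈ (t.seqAt π').verts ∧ v ∈ (t.seqAt π').verts ∧
      (t.seqAt π').Reach ct cb x u v ∧
      MSeq ct cb cd I.mdep t gc gf (w, π) (u, π') ∧
      C ∈ (t.seqAt π').suc v := by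
  obtain ⟨s, hs, -⟩ := hπ.1 π (List.prefix_refl π)
  by_cases hkids : s.kids = []
  · have hrep : RepNode ct cb cd I.mdep t π := by
      refine ⟨hπ.1, ⟨s, hs, hkids⟩, hπ.2, fun hst => ?_⟩
      cases x with
      | true => exact (hst.2 w hw).2.1 C hC
      | false => exact (hst.2 w hw).2.2 C hC
    obtain ⟨hpre, hne, hcomp, hmor⟩ := hγ π hrep
    obtain ⟨s', hs', -⟩ := hcomp.1 (gc π) (List.prefix_refl _)
    have hw' : gf π w ∈ (t.seqAt (gc π)).verts := hmor.1.1 w hw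
    have hC' : Fml.boxF x C ∈ (t.seqAt (gc π)).suc (gf π w) := by
      rwa [SeqTree.suc, ← hmor.2 w hw]
    obtain ⟨π', v, hpre', hπ', hwπ', hvπ', hreach, hv⟩ :=
      exists_box_witness_of_kids_ne_nil hrun hcomp hs'
        (RTree.kids_ne_nil_of_proper_prefix hpre hne hs' hs) hw' hC'
    exact ⟨π', gf π w, v, hπ', hwπ', hvπ', hreach,
      .tail (.single (.rep hrep hw)) (.nat hcomp hπ' hpre' hw'), hv⟩
  · obtain ⟨π', v, hpre, hπ', hwπ', hvπ', hreach, hv⟩ :=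
      exists_box_witness_of_kids_ne_nil hrun hπ hs hkids hw hC
    exact ⟨π', w, v, hπ', hwπ', hvπ', hreach, .single (.nat hπ hπ' hpre hw), hv⟩
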